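/- arXiv:1406.3776 — 2 statements merged into one kernel-verified Lean document; each statement's English description precedes it below -/
import Mathlib

section
/- Assume additionally that q^n ≠ −1 for every n ∈ ℤ. The bilinear map φ: 𝔄_q × 𝔄_q → ℂ defined on basis elements by φ(L_n, I_m) = δ_{n+m,0}·2q^{−n}{n+1}{n}/(1+q^n), φ(I_m, L_n) = −φ(L_n, I_m), and φ = 0 on all other pairs of basis elements satisfies the 2-cocycle identity −φ([x₀,x₁]_q, α_q(x₂)) + (−1)^{|x₁||x₂|} φ([x₀,x₂]_q, α_q(x₁)) + φ(α_q(x₀), [x₁,x₂]_q) = 0 for all homogeneous x₀, x₁, x₂ ∈ 𝔄_q. -/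
open Finsupp

/-- Index type for the basis of the q-deformed Heisenberg-Virasoro superalgebra:
`L m, I m` (even), `G m, T m` (odd), for `m ∈ ℤ`. -/
inductive BIdx : Type
  | L : ℤ → BIdx
  | I : ℤ → BIdx
  | G : ℤ → BIdx
  | T : ℤ → BIdx
  deriving DecidableEq

/-- The underlying super vector space `𝔄_q`: the free `ℂ`-module on the basis `BIdx`. -/
abbrev Aq : Type := BIdx →₀ ℂ

/-- Parity of the basis elements: `L, I` even (`false`), `G, T` odd (`true`). -/
def BIdx.parity : BIdx → Bool
  | .L _ => false
  | .I _ => false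
  | .G _ => true
  | .T _ => true

/-- The `q`-number `{n} = (1 - qⁿ)/(1 - q)`. -/
noncomputable def qnum (q : ℂ) (n : ℤ) : ℂ := (1 - q ^ n) / (1 - q)

/-- The bracket `[·,·]_q` on basis elements (extended by super-skew-symmetry). -/
noncomputable def bk (q : ℂ) : BIdx → BIdx → Aq
  | .L m, .L n => single (.L (m + n)) (qnum q m - qnum q n)
  | .L m, .I n => single (.I (m + n)) (-(qnum q n))
  | .I m, .L n => single (.I (m + n)) (qnum q m)
  | .L m, .G n => single (.G (m + n)) (qnum q m - qnum q (n + 1))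
  | .G m, .L n => single (.G (m + n)) (qnum q (m + 1) - qnum q n)
  | .I m, .G n => single (.T (m + n)) (qnum q m)
  | .G m, .I n => single (.T (m + n)) (-(qnum q n))
  | .L m, .T n => single (.T (m + n)) (-(qnum q (n + 1)))
  | .T m, .L n => single (.T (m + n)) (qnum q (m + 1))
  | _, _ => 0

/-- Bilinear extension of the bracket `[·,·]_q` to all of `𝔄_q`. -/
noncomputable def bkA (q : ℂ) (x y : Aq) : Aq :=
  x.sum fun i a => y.sum fun j b => (a * b) • bk q i j

/-- The eigenvalue of the twist map `α_q` on each basis element. -/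
noncomputable def acoef (q : ℂ) : BIdx → ℂ
  | .L n => 1 + q ^ n
  | .I n => 1 + q ^ n
  | .G n => 1 + q ^ (n + 1)
  | .T n => 1 + q ^ (n + 1)

/-- The even linear twist map `α_q` of `𝔄_q`. -/
noncomputable def alq (q : ℂ) (x : Aq) : Aq :=
  x.sum fun i a => single i (acoef q i * a)

/-- `x` is homogeneous of parity `p`. -/
def homOf (p : Bool) (x : Aq) : Prop := ∀ i ∈ x.support, BIdx.parity i = p

/-- The sign `(−1)^{|x||y|}` for parities `a`, `b`. -/
noncomputable def sgn (a b : Bool) : ℂ := if a && b then -1 else 1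

/-- Evaluation of the bilinear form with basis coefficients `c` on elements of `𝔄_q`. -/
noncomputable def cA (c : BIdx → BIdx → ℂ) (x y : Aq) : ℂ :=
  x.sum fun i a => y.sum fun j b => a * b * c i j

/-- `c` is even: it vanishes on pairs of basis elements of opposite parity. -/
def IsEvenBilinear (c : BIdx → BIdx → ℂ) : Prop :=
  ∀ i j : BIdx, BIdx.parity i ≠ BIdx.parity j → c i j = 0

/-- The 2-cocycle identity (with trivial coefficients) for the bilinear form `c`,
stated for all homogeneous `x₀, x₁, x₂ ∈ 𝔄_q`. -/
def Cocycle2Identity (q : ℂ) (c : BIdx → BIdx → ℂ) : Prop :=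
  ∀ (p0 p1 p2 : Bool) (x0 x1 x2 : Aq), homOf p0 x0 → homOf p1 x1 → homOf p2 x2 →
    -(cA c (bkA q x0 x1) (alq q x2)) + sgn p1 p2 * cA c (bkA q x0 x2) (alq q x1)
      + cA c (alq q x0) (bkA q x1 x2) = 0

/-- An even bilinear 2-cocycle of `𝔄_q` with trivial coefficients. -/
def IsCocycle (q : ℂ) (c : BIdx → BIdx → ℂ) : Prop :=
  IsEvenBilinear c ∧ Cocycle2Identity q c

/-- Evaluation of the linear form with basis coefficients `f` on an element of `𝔄_q`. -/
noncomputable def fA (f : BIdx → ℂ) (x : Aq) : ℂ := x.sum fun i a => a * f i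

/-- `c` is a 2-coboundary: `c(x,y) = −f([x,y]_q)` for some even linear map `f : 𝔄_q → ℂ`. -/
def IsCoboundary (q : ℂ) (c : BIdx → BIdx → ℂ) : Prop :=
  ∃ f : BIdx → ℂ, (∀ i : BIdx, BIdx.parity i = true → f i = 0) ∧
    ∀ i j : BIdx, c i j = -(fA f (bk q i j))

/-- The 2-cocycle `ϕ`, supported on pairs `(L_n, L_{-n})`. -/
noncomputable def phi1 (q : ℂ) : BIdx → BIdx → ℂ
  | .L n, .L m =>
      if n + m = 0 then
        q ^ (-n) * qnum q (n + 1) * qnum q n * qnum q (n - 1) / (6 * (1 + q ^ n))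
      else 0
  | _, _ => 0

/-- Auxiliary value `φ(L_n, I_m)`. -/
noncomputable def phiLI (q : ℂ) (n m : ℤ) : ℂ :=
  if n + m = 0 then 2 * q ^ (-n) * qnum q (n + 1) * qnum q n / (1 + q ^ n) else 0

/-- The 2-cocycle `φ`, supported on pairs `(L_n, I_m)` and `(I_m, L_n)`. -/
noncomputable def phi2 (q : ℂ) : BIdx → BIdx → ℂ
  | .L n, .I m => phiLI q n m
  | .I m, .L n => -phiLI q n m
  | _, _ => 0

/-- The 2-cocycle `ψ`, supported on pairs `(I_n, I_{-n})`. -/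
noncomputable def phi3 (q : ℂ) : BIdx → BIdx → ℂ
  | .I n, .I m => if n + m = 0 then 2 * q ^ m * qnum q n / (1 + q ^ m) else 0
  | _, _ => 0

theorem cA_add_left (c : BIdx → BIdx → ℂ) (x x' y : Aq) :
    cA c (x + x') y = cA c x y + cA c x' y := by
  unfold cA
  rw [Finsupp.sum_add_index']
  · intro i; simp
  · intro i a b; rw [← Finsupp.sum_add]; congr 1; funext j d; ring

theorem cA_add_right (c : BIdx → BIdx → ℂ) (x y y' : Aq) :
    cA c x (y + y') = cA c x y + cA c x y' := by
  unfold cA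
  rw [← Finsupp.sum_add]
  congr 1; funext i a
  rw [Finsupp.sum_add_index']
  · intro i; simp
  · intro i a b; ring

theorem bkA_add_left (q : ℂ) (x x' y : Aq) :
    bkA q (x + x') y = bkA q x y + bkA q x' y := by
  unfold bkA
  rw [Finsupp.sum_add_index']
  · intro i; simp
  · intro i a b; rw [← Finsupp.sum_add]; congr 1; funext j d; rw [add_mul, add_smul]

theorem bkA_add_right (q : ℂ) (x y y' : Aq) :
    bkA q x (y + y') = bkA q x y + bkA q x y' := by
  unfold bkA
  rw [← Finsupp.sum_add]
  congr 1; funext i a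
  rw [Finsupp.sum_add_index']
  · intro i; simp
  · intro i a b; rw [mul_add, add_smul]

theorem alq_add (q : ℂ) (x y : Aq) : alq q (x + y) = alq q x + alq q y := by
  unfold alq
  rw [Finsupp.sum_add_index']
  · intro i; simp
  · intro i a b; rw [mul_add, single_add]

theorem bkA_single (q : ℂ) (i j : BIdx) (a b : ℂ) :
    bkA q (single i a) (single j b) = (a * b) • bk q i j := by
  simp [bkA]

theorem alq_single (q : ℂ) (i : BIdx) (a : ℂ) :
    alq q (single i a) = single i (acoef q i * a) := by
  simp [alq]

theorem cA_single (c : BIdx → BIdx → ℂ) (i j : BIdx) (a b : ℂ) :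
    cA c (single i a) (single j b) = a * b * c i j := by
  simp [cA]

theorem cA_zero_left (c : BIdx → BIdx → ℂ) (y : Aq) : cA c 0 y = 0 := by simp [cA]
theorem cA_zero_right (c : BIdx → BIdx → ℂ) (y : Aq) : cA c y 0 = 0 := by simp [cA]
theorem bkA_zero_left (q : ℂ) (y : Aq) : bkA q 0 y = 0 := by simp [bkA]
theorem bkA_zero_right (q : ℂ) (y : Aq) : bkA q y 0 = 0 := by simp [bkA]
theorem alq_zero (q : ℂ) : alq q 0 = 0 := by simp [alq]

/-- The key scalar identity behind the triple `(L_a, L_b, I_c)`. -/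
theorem phiLI_key (q : ℂ) (hq0 : q ≠ 0) (hq1 : q ≠ 1) (hq : ∀ n : ℤ, q ^ n ≠ -1)
    (a b c : ℤ) :
    -((qnum q a - qnum q b) * (1 + q ^ c) * phiLI q (a + b) c)
      + qnum q c * (1 + q ^ b) * phiLI q b (a + c)
      - (1 + q ^ a) * qnum q c * phiLI q a (b + c) = 0 := by
  by_cases h : a + b + c = 0
  · obtain rfl : c = -(a + b) := by omega
    have h1 : (1 : ℂ) - q ≠ 0 := sub_ne_zero.mpr (Ne.symm hq1)
    have hp : ∀ n : ℤ, 1 + q ^ n ≠ 0 := fun n hn => hq n (by linear_combination hn)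
    have ha := hp a
    have hb := hp b
    have hab := hp (a + b)
    have hA : q ^ a ≠ 0 := zpow_ne_zero a hq0
    have hB : q ^ b ≠ 0 := zpow_ne_zero b hq0
    have e1 : a + b + -(a + b) = 0 := by ring
    have e2 : b + (a + -(a + b)) = 0 := by ring
    have e3 : a + (b + -(a + b)) = 0 := by ring
    simp only [phiLI, qnum, e1, e2, e3, if_true]
    simp only [zpow_neg, zpow_add₀ hq0, zpow_one] at hab ⊢
    generalize q ^ a = A at *
    generalize q ^ b = B at *
    field_simp
    ring
  · have e1 : ¬ (a + b + c = 0) := h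
    have e2 : ¬ (b + (a + c) = 0) := by omega
    have e3 : ¬ (a + (b + c) = 0) := by omega
    simp [phiLI, e1, e2, e3]

theorem cocycle_single (q : ℂ) (hq0 : q ≠ 0) (hq1 : q ≠ 1) (hq : ∀ n : ℤ, q ^ n ≠ -1)
    (i j k : BIdx) (a b d : ℂ) :
    -(cA (phi2 q) (bkA q (single i a) (single j b)) (alq q (single k d)))
      + cA (phi2 q) (bkA q (single i a) (single k d)) (alq q (single j b))
      + cA (phi2 q) (alq q (single i a)) (bkA q (single j b) (single k d)) = 0 := by
  simp only [bkA_single, alq_single]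
  rcases i with l | l | l | l <;> rcases j with m | m | m | m <;> rcases k with n | n | n | n <;>
    simp only [bk, smul_single, smul_zero, cA_single, cA_zero_left, cA_zero_right, phi2, acoef,
      smul_eq_mul, mul_zero, neg_zero, add_zero]
  · linear_combination a * b * d * phiLI_key q hq0 hq1 hq l m n
  · rw [add_comm m n]
    linear_combination -(a * b * d) * phiLI_key q hq0 hq1 hq l n m
  · have h := phiLI_key q hq0 hq1 hq m n l
    rw [add_comm m l, add_comm n l] at h
    linear_combination a * b * d * h

theorem cocycle_all (q : ℂ) (hq0 : q ≠ 0) (hq1 : q ≠ 1) (hq : ∀ n : ℤ, q ^ n ≠ -1)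
    (x y z : Aq) :
    -(cA (phi2 q) (bkA q x y) (alq q z)) + cA (phi2 q) (bkA q x z) (alq q y)
      + cA (phi2 q) (alq q x) (bkA q y z) = 0 := by
  induction x using Finsupp.induction_linear with
  | zero => simp [bkA_zero_left, alq_zero, cA_zero_left]
  | add x x' h h' =>
    simp only [bkA_add_left, alq_add, cA_add_left]
    linear_combination h + h'
  | single i a =>
    induction y using Finsupp.induction_linear with
    | zero => simp [bkA_zero_left, bkA_zero_right, alq_zero, cA_zero_left, cA_zero_right]
    | add x x' h h' =>
      simp only [bkA_add_left, bkA_add_right, alq_add, cA_add_left, cA_add_right]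
      linear_combination h + h'
    | single j b =>
      induction z using Finsupp.induction_linear with
      | zero => simp [bkA_zero_right, alq_zero, cA_zero_left, cA_zero_right]
      | add x x' h h' =>
        simp only [bkA_add_right, alq_add, cA_add_left, cA_add_right]
        linear_combination h + h'
      | single k d => exact cocycle_single q hq0 hq1 hq i j k a b d

theorem alq_apply (q : ℂ) (x : Aq) (k : BIdx) : alq q x k = acoef q k * x k := by
  induction x using Finsupp.induction_linear with
  | zero => simp [alq_zero]
  | add x y h h' => simp only [alq_add, Finsupp.add_apply, h, h']; ring
  | single i a =>
    rw [alq_single]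
    by_cases h : i = k
    · subst h; simp
    · simp [Finsupp.single_apply, h]

theorem phi2_odd_right (q : ℂ) (i j : BIdx) (h : j.parity = true) : phi2 q i j = 0 := by
  rcases i with l | l | l | l <;> rcases j with m | m | m | m <;> simp_all [phi2, BIdx.parity]

theorem cA_odd_right (q : ℂ) (u x : Aq) (hx : homOf true x) :
    cA (phi2 q) u (alq q x) = 0 := by
  unfold cA
  refine Finset.sum_eq_zero fun i _ => Finset.sum_eq_zero fun j hj => ?_
  have hj' : j ∈ x.support := by
    rw [Finsupp.mem_support_iff] at hj ⊢
    intro h0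
    exact hj (by rw [alq_apply, h0, mul_zero])
  simp only [phi2_odd_right q i j (hx j hj'), mul_zero]

/-- assuming `qⁿ ≠ −1` for all `n ∈ ℤ`, the bilinear map `φ = phi2`
satisfies the 2-cocycle identity for all homogeneous `x₀, x₁, x₂ ∈ 𝔄_q`. -/
theorem phi2_is_two_cocycle (q : ℂ) (hq0 : q ≠ 0) (hq1 : q ≠ 1)
    (hq : ∀ n : ℤ, q ^ n ≠ -1) :
    Cocycle2Identity q (phi2 q) := by
  intro p0 p1 p2 x0 x1 x2 _ h1 _
  have key := cocycle_all q hq0 hq1 hq x0 x1 x2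
  cases p1 with
  | false => simpa [sgn] using key
  | true =>
    rw [cA_odd_right q _ x1 h1] at key ⊢
    simpa using key
end

section
/- For every s ∈ ℤ with q^{s+1} ≠ −1, the inner maps ad_{G_s}: x ↦ [G_s, x]_q and ad_{T_s}: x ↦ [T_s, x]_q are odd q-derivations of 𝔄_q homogeneous of degree s; that is, they map span{L_n, I_n} into span{G_{n+s}, T_{n+s}} and span{G_n, T_n} into span{L_{n+s}, I_{n+s}}, and satisfy φ([x,y]_q) = (1+q^{s+1})^{−1}([φ(x), α_q(y)]_q + (−1)^{|x|}[α_q(x), φ(y)]_q) for all homogeneous x, y. -/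
open Finsupp

/-- The span of the basis elements `L_n, I_n`. -/
noncomputable def spanLI (n : ℤ) : Submodule ℂ Aq :=
  Submodule.span ℂ {single (BIdx.L n) (1 : ℂ), single (BIdx.I n) (1 : ℂ)}

/-- The span of the basis elements `G_n, T_n`. -/
noncomputable def spanGT (n : ℤ) : Submodule ℂ Aq :=
  Submodule.span ℂ {single (BIdx.G n) (1 : ℂ), single (BIdx.T n) (1 : ℂ)}

/-- The linear extension of a map `D` given by its values on the basis. -/
noncomputable def DA (D : BIdx → Aq) (x : Aq) : Aq := x.sum fun i a => a • D i

/-- The sign `(−1)^{|x|}` for a parity `b`. -/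
noncomputable def sgn1 (b : Bool) : ℂ := if b then -1 else 1

/-- `φ` (given by its values on the basis, extended linearly) is an odd `q`-derivation of
`𝔄_q` homogeneous of degree `s`: it maps `span{L_n, I_n}` into `span{G_{n+s}, T_{n+s}}`
and `span{G_n, T_n}` into `span{L_{n+s}, I_{n+s}}`, and satisfies
`φ([x,y]_q) = (1+q^{s+1})⁻¹ ([φ x, α_q y]_q + (−1)^{|x|}[α_q x, φ y]_q)`
for homogeneous `x, y`. -/
def IsOddQDerivationSpan (q : ℂ) (s : ℤ) (φ : BIdx → Aq) : Prop :=
  (∀ n : ℤ, ∀ x ∈ spanLI n, DA φ x ∈ spanGT (n + s)) ∧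
  (∀ n : ℤ, ∀ x ∈ spanGT n, DA φ x ∈ spanLI (n + s)) ∧
  ∀ (px py : Bool) (x y : Aq), homOf px x → homOf py y →
    DA φ (bkA q x y) =
      (1 + q ^ (s + 1))⁻¹ •
        (bkA q (DA φ x) (alq q y) + sgn1 px • bkA q (alq q x) (DA φ y))

noncomputable def brL (q : ℂ) : Aq →ₗ[ℂ] Aq →ₗ[ℂ] Aq :=
  Finsupp.linearCombination ℂ (fun i => Finsupp.linearCombination ℂ (bk q i))

noncomputable def alL (q : ℂ) : Aq →ₗ[ℂ] Aq :=
  Finsupp.linearCombination ℂ (fun i => single i (acoef q i))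

/-- The twist composed with the parity sign. -/
noncomputable def beL (q : ℂ) : Aq →ₗ[ℂ] Aq :=
  Finsupp.linearCombination ℂ (fun i => single i (sgn1 i.parity * acoef q i))

lemma bkA_eq (q : ℂ) (x y : Aq) : bkA q x y = brL q x y := by
  simp only [bkA, brL, Finsupp.linearCombination_apply, Finsupp.sum, LinearMap.sum_apply,
    LinearMap.smul_apply, Finset.smul_sum, mul_smul]

lemma alq_eq (q : ℂ) (x : Aq) : alq q x = alL q x := by
  simp only [alq, alL, Finsupp.linearCombination_apply, Finsupp.smul_single, smul_eq_mul,
    mul_comm]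

lemma DA_eq (D : BIdx → Aq) (x : Aq) : DA D x = Finsupp.linearCombination ℂ D x := rfl

lemma beL_eq (q : ℂ) (p : Bool) (x : Aq) (hx : homOf p x) : sgn1 p • alL q x = beL q x := by
  simp only [alL, beL, Finsupp.linearCombination_apply, Finsupp.sum, Finset.smul_sum]
  refine Finset.sum_congr rfl fun i hi => ?_
  rw [hx i hi]
  simp only [Finsupp.smul_single, smul_eq_mul]
  congr 1
  ring

lemma deriv_of_basis (q : ℂ) (s : ℤ) (D : BIdx → Aq) (hs : 1 + q ^ (s + 1) ≠ 0)
    (h : ∀ i j, (1 + q ^ (s + 1)) • Finsupp.linearCombination ℂ D (bk q i j) =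
      acoef q j • brL q (D i) (single j 1) +
      (sgn1 i.parity * acoef q i) • brL q (single i 1) (D j))
    (px py : Bool) (x y : Aq) (hx : homOf px x) (_hy : homOf py y) :
    DA D (bkA q x y) =
      (1 + q ^ (s + 1))⁻¹ •
        (bkA q (DA D x) (alq q y) + sgn1 px • bkA q (alq q x) (DA D y)) := by
  rw [eq_inv_smul_iff₀ hs]
  simp only [bkA_eq, alq_eq, DA_eq]
  have hb : sgn1 px • brL q (alL q x) (Finsupp.linearCombination ℂ D y) =
      brL q (beL q x) (Finsupp.linearCombination ℂ D y) := by
    rw [← beL_eq q px x hx, map_smul, LinearMap.smul_apply]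
  rw [hb]
  have key : (1 + q ^ (s + 1)) • (brL q).compr₂ (Finsupp.linearCombination ℂ D) =
      (brL q).compl₁₂ (Finsupp.linearCombination ℂ D) (alL q) +
      (brL q).compl₁₂ (beL q) (Finsupp.linearCombination ℂ D) := by
    refine Finsupp.lhom_ext' fun i => LinearMap.ext_ring ?_
    refine Finsupp.lhom_ext' fun j => LinearMap.ext_ring ?_
    have h1 : alL q (single j 1) = acoef q j • single j 1 := by simp [alL]
    have h2 : beL q (single i 1) = (sgn1 i.parity * acoef q i) • single i 1 := by simp [beL]
    have h3 : brL q (single i 1) (single j 1) = bk q i j := by simp [brL]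
    have := h i j
    simp only [LinearMap.comp_apply, Finsupp.lsingle_apply, LinearMap.add_apply,
      LinearMap.smul_apply, LinearMap.compr₂_apply, LinearMap.compl₁₂_apply, h1, h2, h3,
      map_smul, this, Finsupp.linearCombination_single, one_smul]
  have := LinearMap.congr_fun (LinearMap.congr_fun key x) y
  simpa using this

lemma brL_single (q : ℂ) (i j : BIdx) (a b : ℂ) :
    brL q (single i a) (single j b) = (a * b) • bk q i j := by
  simp [brL, mul_smul]

lemma span_map (D : BIdx → Aq) (a b : BIdx) (S : Submodule ℂ Aq) (ha : D a ∈ S) (hb : D b ∈ S)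
    (x : Aq) (hx : x ∈ Submodule.span ℂ {single a (1 : ℂ), single b (1 : ℂ)}) : DA D x ∈ S := by
  rw [DA_eq]
  obtain ⟨c, d, rfl⟩ := Submodule.mem_span_pair.1 hx
  simp only [map_add, map_smul, Finsupp.linearCombination_single, one_smul]
  exact S.add_mem (S.smul_mem _ ha) (S.smul_mem _ hb)

lemma G_mem (n : ℤ) (m : ℤ) (h : m = n) (a : ℂ) : single (BIdx.G m) a ∈ spanGT n :=
  Submodule.mem_span_pair.2 ⟨a, 0, by simp [h]⟩

lemma T_mem (n : ℤ) (m : ℤ) (h : m = n) (a : ℂ) : single (BIdx.T m) a ∈ spanGT n :=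
  Submodule.mem_span_pair.2 ⟨0, a, by simp [h]⟩

/-- for every `s ∈ ℤ` with `q^{s+1} ≠ −1`, the inner maps
`ad_{G_s} : x ↦ [G_s, x]_q` and `ad_{T_s} : x ↦ [T_s, x]_q` are odd `q`-derivations of
`𝔄_q` homogeneous of degree `s`. -/
theorem ad_G_and_ad_T_are_odd_q_derivations
    (q : ℂ) (hq0 : q ≠ 0) (hq1 : q ≠ 1) (s : ℤ) (hqs : q ^ (s + 1) ≠ -1) :
    IsOddQDerivationSpan q s (fun i => bk q (.G s) i) ∧
    IsOddQDerivationSpan q s (fun i => bk q (.T s) i) := by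
  have hs : 1 + q ^ (s + 1) ≠ 0 := fun h => hqs (by linear_combination h)
  have hq : 1 - q ≠ 0 := sub_ne_zero.2 (Ne.symm hq1)
  refine ⟨⟨fun n => span_map _ _ _ _ (G_mem _ _ (add_comm _ _) _) (T_mem _ _ (add_comm _ _) _),
    fun n => span_map _ _ _ _ (Submodule.zero_mem _) (Submodule.zero_mem _),
    deriv_of_basis q s _ hs ?_⟩,
    ⟨fun n => span_map _ _ _ _ (T_mem _ _ (add_comm _ _) _) (Submodule.zero_mem _),
    fun n => span_map _ _ _ _ (Submodule.zero_mem _) (Submodule.zero_mem _),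
    deriv_of_basis q s _ hs ?_⟩⟩
  all_goals
    rintro (m | m | m | m) (n | n | n | n) <;>
    simp only [bk, brL_single, map_zero, LinearMap.zero_apply, smul_zero, add_zero,
      Finsupp.linearCombination_single, Finsupp.smul_single, smul_eq_mul, BIdx.parity, sgn1,
      acoef]
  all_goals
    try simp only [show m + (s + n) = s + (m + n) by ring, show s + m + n = s + (m + n) by ring,
      ← Finsupp.single_add]
    try rw [← Finsupp.single_zero (BIdx.T (s + (m + n)))]
    try congr 1
    try simp only [qnum, zpow_add₀ hq0, zpow_one]
    try field_simp
    try simp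
    try ring
end
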